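/- arXiv:1511.04570 — 2 statements merged into one kernel-verified Lean document; each statement's English description precedes it below -/
import Mathlib

section
/- Cartan's Nullstellensatz: Let f₁,...,f_N be entire functions on ℂⁿ. Then there exist entire functions g₁,...,g_N on ℂⁿ with ∑_{j=1}^N g_j f_j = 1 if and only if the functions f_j have no common zero in ℂⁿ. -/
open scoped BigOperators

section

open Set Filter Topology Metric Complex MeasureTheory

/-- Cauchy's estimate for the Fréchet derivative of a bounded holomorphic function on a ball. -/
theorem norm_fderiv_le_of_forall_mem_ball {E : Type*} [NormedAddCommGroup E] [NormedSpace ℂ E]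
    {f : E → ℂ} {c : E} {R M : ℝ} (hR : 0 < R) (hf : DifferentiableOn ℂ f (ball c R))
    (hM : ∀ z ∈ ball c R, ‖f z‖ ≤ M) : ‖fderiv ℂ f c‖ ≤ 2 * M / R := by
  refine norm_fderiv_le_div_of_mapsTo_ball hf (fun z hz ↦ ?_) hR
  rw [mem_closedBall, dist_eq_norm]
  linarith [norm_sub_le (f z) (f c), hM z hz, hM c (mem_ball_self hR)]

/-- An integral over a compact interval of functions depending holomorphically on a parameter
is holomorphic in the parameter. -/
theorem differentiableOn_intervalIntegral {E : Type*} [NormedAddCommGroup E] [NormedSpace ℂ E]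
    [ProperSpace E] {F : E → ℝ → ℂ} {V : Set E} {p q : ℝ} (hV : IsOpen V)
    (hc : ContinuousOn (Function.uncurry F) (V ×ˢ uIcc p q))
    (hd : ∀ t ∈ uIcc p q, DifferentiableOn ℂ (fun z ↦ F z t) V) :
    DifferentiableOn ℂ (fun z ↦ ∫ t in p..q, F z t) V := by
  intro z₀ hz₀
  obtain ⟨r, hr, hrV⟩ : ∃ r > 0, closedBall z₀ (2 * r) ⊆ V := by
    obtain ⟨r, hr, h⟩ := nhds_basis_closedBall.mem_iff.1 (hV.mem_nhds hz₀)
    exact ⟨r / 2, by positivity, by rwa [mul_div_cancel₀ r two_ne_zero]⟩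
  have hsub : ∀ z ∈ ball z₀ r, ball z r ⊆ closedBall z₀ (2 * r) := fun z hz w hw ↦ by
    rw [mem_ball] at hz hw
    rw [mem_closedBall]
    linarith [dist_triangle w z z₀]
  obtain ⟨M, hM⟩ := ((isCompact_closedBall z₀ (2 * r)).prod
    (isCompact_uIcc (a := p) (b := q))).exists_bound_of_continuousOn
    (hc.mono (prod_mono_left hrV))
  have hcont : ∀ z ∈ V, ContinuousOn (F z) (uIcc p q) := fun z hz ↦
    hc.comp (f := fun t : ℝ ↦ (z, t)) (by fun_prop) fun t ht ↦ ⟨hz, ht⟩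
  have hmeas : ∀ z ∈ V, IntervalIntegrable (F z) volume p q := fun z hz ↦
    (hcont z hz).intervalIntegrable
  have hder : ∀ t ∈ uIcc p q, ∀ z ∈ V, DifferentiableAt ℂ (fun z ↦ F z t) z := fun t ht z hz ↦
    (hd t ht).differentiableAt (hV.mem_nhds hz)
  have hfc : ContinuousOn (fun t ↦ fderiv ℂ (fun z ↦ F z t) z₀) (uIcc p q) := by
    intro t ht
    rw [ContinuousWithinAt, Metric.tendsto_nhds]
    intro ε hε
    have hsw : ContinuousOn (Function.uncurry fun t z ↦ F z t)
        (uIcc p q ×ˢ closedBall z₀ (2 * r)) :=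
      hc.comp (f := fun x : ℝ × E ↦ (x.2, x.1)) (by fun_prop) fun x hx ↦ ⟨hrV hx.2, hx.1⟩
    obtain ⟨v, hv, hvu⟩ := (isCompact_closedBall z₀ (2 * r)).mem_uniformity_of_prod hsw ht
      (Metric.dist_mem_uniformity (show 0 < ε * r / 4 by positivity))
    filter_upwards [hv, self_mem_nhdsWithin] with u hu hut
    have hz₀r := hsub z₀ (mem_ball_self hr)
    have := norm_fderiv_le_of_forall_mem_ball (f := fun z ↦ F z u - F z t) (M := ε * r / 4) hr
      (((hd u hut).sub (hd t ht)).mono (hz₀r.trans hrV)) fun z hz ↦ by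
        rw [← dist_eq_norm]
        exact le_of_lt (hvu u hu z (hz₀r hz))
    rw [dist_eq_norm, ← fderiv_fun_sub (hder u hut z₀ hz₀) (hder t ht z₀ hz₀)]
    refine this.trans_lt ?_
    rw [div_lt_iff₀ hr]
    nlinarith [mul_pos hε hr]
  refine (intervalIntegral.hasFDerivAt_integral_of_dominated_of_fderiv_le (𝕜 := ℂ)
    (F' := fun z t ↦ fderiv ℂ (fun z ↦ F z t) z) (bound := fun _ ↦ 2 * M / r)
    (ball_mem_nhds z₀ hr) ?_ (hmeas z₀ hz₀) ?_ ?_ (by simp) ?_).differentiableAt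
    |>.differentiableWithinAt
  · filter_upwards [hV.mem_nhds hz₀] with z hz
    exact (intervalIntegrable_iff.1 (hmeas z hz)).aestronglyMeasurable
  · exact (intervalIntegrable_iff.1 hfc.intervalIntegrable).aestronglyMeasurable
  · refine Eventually.of_forall fun t ht z hz ↦ ?_
    exact norm_fderiv_le_of_forall_mem_ball hr
      ((hd t (uIoc_subset_uIcc ht)).mono ((hsub z hz).trans hrV))
      fun w hw ↦ hM (w, t) ⟨hsub z hz hw, uIoc_subset_uIcc ht⟩
  · refine Eventually.of_forall fun t ht z hz ↦ ?_
    exact (hder t (uIoc_subset_uIcc ht) z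
      (hrV (hsub z hz (mem_ball_self hr)))).hasFDerivAt

/-- A uniform limit of holomorphic functions on a ball is differentiable at the center. -/
theorem differentiableAt_of_tendstoUniformlyOn_ball {E : Type*} [NormedAddCommGroup E]
    [NormedSpace ℂ E] {G : ℕ → E → ℂ} {g : E → ℂ} {c : E} {R : ℝ} (hR : 0 < R)
    (hG : ∀ m, DifferentiableOn ℂ (G m) (ball c R))
    (hlim : TendstoUniformlyOn G g atTop (ball c R)) : DifferentiableAt ℂ g c := by
  have hr : 0 < R / 2 := half_pos hR
  have hsub : ∀ z ∈ ball c (R / 2), ball z (R / 2) ⊆ ball c R := fun z hz w hw ↦ by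
    rw [mem_ball] at hz hw ⊢
    linarith [dist_triangle w z c]
  have hda : ∀ m, ∀ z ∈ ball c (R / 2), DifferentiableAt ℂ (G m) z := fun m z hz ↦
    (hG m).differentiableAt (isOpen_ball.mem_nhds (hsub z hz (mem_ball_self hr)))
  have hC : UniformCauchySeqOn (fun m ↦ fderiv ℂ (G m)) atTop (ball c (R / 2)) := by
    rw [Metric.uniformCauchySeqOn_iff]
    intro ε hε
    obtain ⟨N, hN⟩ := Metric.uniformCauchySeqOn_iff.1 hlim.uniformCauchySeqOn (ε * (R / 2) / 4)
      (by positivity)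
    refine ⟨N, fun m hm n hn z hz ↦ ?_⟩
    rw [dist_eq_norm, ← fderiv_sub (hda m z hz) (hda n z hz)]
    have := norm_fderiv_le_of_forall_mem_ball (f := G m - G n) (M := ε * (R / 2) / 4) hr
      (((hG m).sub (hG n)).mono (hsub z hz)) fun w hw ↦ by
        rw [Pi.sub_apply, ← dist_eq_norm]
        exact le_of_lt (hN m hm n hn w (hsub z hz hw))
    refine this.trans_lt ?_
    rw [div_lt_iff₀ hr]
    nlinarith [mul_pos hε hr]
  choose! g' hg' using fun z (hz : z ∈ ball c (R / 2)) ↦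
    cauchySeq_tendsto_of_complete (hC.cauchySeq hz)
  exact (hasFDerivAt_of_tendstoUniformlyOn isOpen_ball
    (hC.tendstoUniformlyOn_of_tendsto hg') (fun m z hz ↦ (hda m z hz).hasFDerivAt)
    (fun z hz ↦ hlim.tendsto_at (hsub z hz (mem_ball_self hr)))
    (mem_ball_self hr)).differentiableAt

/-- Holomorphic functions on a ball are uniformly approximated on smaller balls by entire
functions. -/
theorem exists_entire_approx {E : Type*} [NormedAddCommGroup E] [NormedSpace ℂ E] [ProperSpace E]
    {f : E → ℂ} {r R ε : ℝ} (hr : 0 < r) (hrR : r < R) (hε : 0 < ε)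
    (hf : DifferentiableOn ℂ f (ball 0 R)) :
    ∃ p : E → ℂ, Differentiable ℂ p ∧ ∀ z ∈ ball (0 : E) r, ‖f z - p z‖ < ε := by
  have hR : 0 < R := hr.trans hrR
  obtain ⟨ρ, hrρ, hρR⟩ := exists_between hrR
  have hρ : 0 < ρ := hr.trans hrρ
  have hline : ∀ (z : E) (τ : ℝ), τ * ‖z‖ < R → ∀ w ∈ closedBall (0 : ℂ) τ, w • z ∈ ball 0 R := by
    intro z τ h w hw
    rw [mem_closedBall_zero_iff] at hw
    rw [mem_ball_zero_iff, norm_smul]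
    exact (mul_le_mul_of_nonneg_right hw (norm_nonneg z)).trans_lt h
  have hdline : ∀ (z : E) (τ : ℝ), τ * ‖z‖ < R →
      DifferentiableOn ℂ (fun w : ℂ ↦ f (w • z)) (closedBall 0 τ) := fun z τ h ↦
    hf.comp (by fun_prop) (hline z τ h)
  let a : ℕ → E → ℂ := fun k z ↦ iteratedDeriv k (fun w : ℂ ↦ f (w • z)) 0
  have ha : ∀ k, Differentiable ℂ (a k) := by
    intro k z₀
    let τ := R / (2 * (‖z₀‖ + 1))
    have hτ : 0 < τ := by positivity
    have hb : ∀ z ∈ ball z₀ 1, τ * ‖z‖ < R := by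
      intro z hz
      rw [mem_ball, dist_eq_norm] at hz
      have h1 : ‖z‖ < ‖z₀‖ + 1 := by linarith [norm_sub_norm_le z z₀]
      have h2 : τ * (‖z₀‖ + 1) = R / 2 := by simp only [τ]; field_simp
      nlinarith
    have hci : DifferentiableOn ℂ
        (fun z ↦ ∮ w in C(0, τ), (1 / (w - 0) ^ (k + 1)) • f (w • z)) (ball z₀ 1) := by
      unfold circleIntegral
      refine differentiableOn_intervalIntegral isOpen_ball ?_ ?_
      · have h1 : ContinuousOn (fun x : E × ℝ ↦ f (circleMap 0 τ x.2 • x.1))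
            (ball z₀ 1 ×ˢ uIcc 0 (2 * Real.pi)) :=
          hf.continuousOn.comp (by fun_prop) fun x hx ↦
            hline x.1 τ (hb x.1 hx.1) _ (circleMap_mem_closedBall 0 hτ.le x.2)
        have h2 : Continuous fun x : E × ℝ ↦
            deriv (circleMap 0 τ) x.2 * (1 / (circleMap 0 τ x.2 - 0) ^ (k + 1)) := by
          simp only [deriv_circleMap]
          refine Continuous.mul (by fun_prop) (Continuous.div (by fun_prop) (by fun_prop) ?_)
          intro x
          exact pow_ne_zero _ (sub_ne_zero.2 (circleMap_ne_center hτ.ne'))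
        refine (h2.continuousOn.mul h1).congr fun x _ ↦ ?_
        simp [Function.uncurry, mul_assoc]
      · intro t _
        have h1 : DifferentiableOn ℂ (fun z ↦ f (circleMap 0 τ t • z)) (ball z₀ 1) :=
          hf.comp (by fun_prop) fun z hz ↦
            hline z τ (hb z hz) _ (circleMap_mem_closedBall 0 hτ.le t)
        exact (h1.const_smul (1 / (circleMap 0 τ t - 0) ^ (k + 1))).const_smul
          (deriv (circleMap 0 τ) t)
    have heq : ∀ z ∈ ball z₀ 1, a k z = (2 * Real.pi * I / k.factorial)⁻¹ *
        ∮ w in C(0, τ), (1 / (w - 0) ^ (k + 1)) • f (w • z) := by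
      intro z hz
      rw [(hdline z τ (hb z hz)).circleIntegral_one_div_sub_center_pow_smul hτ k, smul_eq_mul,
        inv_mul_cancel_left₀]
      simp [Nat.factorial_ne_zero, Real.pi_ne_zero]
    exact ((hci.const_mul _).congr heq).differentiableAt (ball_mem_nhds z₀ one_pos)
  obtain ⟨M, hM⟩ := (isCompact_closedBall (0 : E) ρ).exists_bound_of_continuousOn
    (hf.continuousOn.mono (closedBall_subset_ball hρR))
  have hM0 : 0 ≤ M := (norm_nonneg _).trans (hM 0 (mem_closedBall_self hρ.le))
  have hT : 1 < ρ / r := (one_lt_div hr).2 hrρ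
  have hq : r / ρ < 1 := (div_lt_one hρ).2 hrρ
  obtain ⟨K, hK⟩ : ∃ K : ℕ, M * (r / ρ) ^ K / (1 - r / ρ) < ε := by
    have : Tendsto (fun K : ℕ ↦ M * (r / ρ) ^ K / (1 - r / ρ)) atTop (𝓝 (M * 0 / (1 - r / ρ))) :=
      ((tendsto_pow_atTop_nhds_zero_of_lt_one (by positivity) hq).const_mul M).div_const _
    rw [mul_zero, zero_div] at this
    exact (this.eventually (gt_mem_nhds hε)).exists
  refine ⟨fun z ↦ ∑ k ∈ Finset.range K, (k.factorial : ℂ)⁻¹ * a k z, ?_, fun z hz ↦ ?_⟩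
  · exact Differentiable.fun_sum fun k _ ↦ (ha k).const_mul _
  · rw [mem_ball_zero_iff] at hz
    have hzρ : ρ / r * ‖z‖ ≤ ρ := by
      rw [div_mul_eq_mul_div, div_le_iff₀ hr]
      exact mul_le_mul_of_nonneg_left hz.le hρ.le
    have hdl := hdline z (ρ / r) (hzρ.trans_lt hρR)
    have hsum := hasSum_taylorSeries_on_ball (hdl.mono ball_subset_closedBall) (z := 1)
      (by simpa using hT)
    simp only [sub_zero, one_pow, one_smul, smul_eq_mul, one_mul] at hsum
    have hbd : ∀ k : ℕ, ‖(k.factorial : ℂ)⁻¹ * a k z‖ ≤ M * (r / ρ) ^ k := by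
      intro k
      have := norm_iteratedDeriv_le_of_forall_mem_sphere_norm_le (C := M) k
        (show 0 < ρ / r by positivity)
        ((hdl.mono closure_ball_subset_closedBall).diffContOnCl) fun w hw ↦ by
          refine hM _ ?_
          rw [mem_sphere_zero_iff_norm] at hw
          rwa [mem_closedBall_zero_iff, norm_smul, hw]
      rw [norm_mul, norm_inv, Complex.norm_natCast]
      calc _ ≤ (k.factorial : ℝ)⁻¹ * (k.factorial * M / (ρ / r) ^ k) := by
            gcongr
        _ = M * (r / ρ) ^ k := by
            rw [mul_div_assoc, inv_mul_cancel_left₀ (mod_cast k.factorial_ne_zero),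
              div_eq_mul_inv, ← inv_pow, inv_div]
    have := norm_sub_le_of_geometric_bound_of_hasSum hq hbd hsum K
    rw [norm_sub_rev]
    exact this.trans_lt hK

theorem log_I_mul_of_re_pos_of_im_neg {u : ℂ} (hre : 0 < u.re) (him : u.im < 0) :
    log (I * u) = log u + Real.pi / 2 * I := by
  have hu : u ≠ 0 := fun h ↦ by simp [h] at hre
  have h1 : arg u < 0 := arg_neg_iff.2 him
  have h2 := (abs_lt.1 (abs_arg_lt_pi_div_two_iff.2 (Or.inl hre))).1
  rw [(log_mul_eq_add_log_iff I_ne_zero hu).2, log_I, add_comm]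
  rw [arg_I]
  constructor <;> linarith [Real.pi_pos]

theorem integral_inv_eq_log_sub_log {γ : ℝ → ℂ} {d u : ℂ} {p q : ℝ}
    (hγ : ∀ t, HasDerivAt γ d t) (hu : u ≠ 0) (hpos : ∀ t ∈ uIcc p q, 0 < (u * γ t).re) :
    ∫ t in p..q, d * (γ t)⁻¹ = log (u * γ q) - log (u * γ p) := by
  have hne : ∀ t ∈ uIcc p q, γ t ≠ 0 := fun t ht h ↦ by
    have := hpos t ht
    simp [h] at this
  have hcont : Continuous γ := continuous_iff_continuousAt.2 fun t ↦ (hγ t).continuousAt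
  refine intervalIntegral.integral_eq_sub_of_hasDerivAt (f := fun t ↦ log (u * γ t))
    (fun t ht ↦ ?_) ?_
  · have h := ((hγ t).const_mul u).clog_real (Or.inl (hpos t ht))
    rwa [mul_div_mul_left _ _ hu, div_eq_mul_inv] at h
  · exact (continuousOn_const.mul (hcont.continuousOn.inv₀ hne)).intervalIntegrable

/-- The integral of `(ζ - w)⁻¹` along the boundary of a rectangle around `w` is `2πi`. -/
theorem integral_boundary_rect_inv_sub {x₀ x₁ y₀ y₁ : ℝ} {w : ℂ} (hx₀ : x₀ < w.re)
    (hx₁ : w.re < x₁) (hy₀ : y₀ < w.im) (hy₁ : w.im < y₁) :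
    (∫ x in x₀..x₁, ((x : ℂ) + y₀ * I - w)⁻¹) - (∫ x in x₀..x₁, ((x : ℂ) + y₁ * I - w)⁻¹) +
      I * (∫ y in y₀..y₁, ((x₁ : ℂ) + y * I - w)⁻¹) -
      I * (∫ y in y₀..y₁, ((x₀ : ℂ) + y * I - w)⁻¹) = 2 * Real.pi * I := by
  have hh : ∀ y t : ℝ, HasDerivAt (fun x : ℝ ↦ (x : ℂ) + y * I - w) 1 t := fun y t ↦
    ((hasDerivAt_id (t : ℂ)).comp_ofReal.add_const _).sub_const _
  have hv : ∀ x t : ℝ, HasDerivAt (fun y : ℝ ↦ (x : ℂ) + y * I - w) I t := fun x t ↦ by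
    simpa using (((hasDerivAt_id (t : ℂ)).comp_ofReal.mul_const I).const_add (x : ℂ)).sub_const w
  have e1 := integral_inv_eq_log_sub_log (hh y₀) (u := I) (p := x₀) (q := x₁) I_ne_zero
    (by intro t _; simp; linarith)
  have e2 := integral_inv_eq_log_sub_log (hh y₁) (u := -I) (p := x₀) (q := x₁)
    (neg_ne_zero.2 I_ne_zero) (by intro t _; simp; linarith)
  have e3 := integral_inv_eq_log_sub_log (hv x₁) (u := 1) (p := y₀) (q := y₁) one_ne_zero
    (by intro t _; simp; linarith)
  have e4 := integral_inv_eq_log_sub_log (hv x₀) (u := -1) (p := y₀) (q := y₁)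
    (neg_ne_zero.2 one_ne_zero) (by intro t _; simp; linarith)
  simp only [one_mul] at e1 e2 e3
  rw [intervalIntegral.integral_const_mul] at e3 e4
  rw [e1, e2, e3, e4]
  have c1 := log_I_mul_of_re_pos_of_im_neg (u := (x₁ : ℂ) + y₀ * I - w)
    (by simp; linarith) (by simp; linarith)
  have c2 := log_I_mul_of_re_pos_of_im_neg (u := -I * ((x₁ : ℂ) + y₁ * I - w))
    (by simp; linarith) (by simp; linarith)
  have c3 := log_I_mul_of_re_pos_of_im_neg (u := -1 * ((x₀ : ℂ) + y₁ * I - w))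
    (by simp; linarith) (by simp; linarith)
  have c4 := log_I_mul_of_re_pos_of_im_neg (u := I * ((x₀ : ℂ) + y₀ * I - w))
    (by simp; linarith) (by simp; linarith)
  rw [show I * (-I * ((x₁ : ℂ) + y₁ * I - w)) = (x₁ : ℂ) + y₁ * I - w by
    linear_combination (-((x₁ : ℂ) + y₁ * I - w)) * I_mul_I] at c2
  rw [show I * (-1 * ((x₀ : ℂ) + y₁ * I - w)) = -I * ((x₀ : ℂ) + y₁ * I - w) by ring] at c3
  rw [show I * (I * ((x₀ : ℂ) + y₀ * I - w)) = -1 * ((x₀ : ℂ) + y₀ * I - w) by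
    linear_combination ((x₀ : ℂ) + y₀ * I - w) * I_mul_I] at c4
  rw [c1, c2, c3, c4]
  ring

/-- **Cauchy integral formula** for a rectangle. -/
theorem integral_boundary_rect_inv_sub_mul {x₀ x₁ y₀ y₁ : ℝ} {w : ℂ} {φ : ℂ → ℂ}
    (hx₀ : x₀ < w.re) (hx₁ : w.re < x₁) (hy₀ : y₀ < w.im) (hy₁ : w.im < y₁)
    (hφ : ∀ ζ : ℂ, ζ.re ∈ Icc x₀ x₁ → ζ.im ∈ Icc y₀ y₁ → DifferentiableAt ℂ φ ζ) :
    (∫ x in x₀..x₁, ((x : ℂ) + y₀ * I - w)⁻¹ * φ (x + y₀ * I)) -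
      (∫ x in x₀..x₁, ((x : ℂ) + y₁ * I - w)⁻¹ * φ (x + y₁ * I)) +
      I * (∫ y in y₀..y₁, ((x₁ : ℂ) + y * I - w)⁻¹ * φ (x₁ + y * I)) -
      I * (∫ y in y₀..y₁, ((x₀ : ℂ) + y * I - w)⁻¹ * φ (x₀ + y * I)) = 2 * Real.pi * I * φ w := by
  have hx : x₀ ≤ x₁ := (hx₀.trans hx₁).le
  have hy : y₀ ≤ y₁ := (hy₀.trans hy₁).le
  have key := integral_boundary_rect_eq_zero_of_differentiable_on_off_countable (dslope φ w)
    (x₀ + y₀ * I) (x₁ + y₁ * I) {w} (countable_singleton w) ?_ ?_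
  · simp only [add_re, ofReal_re, mul_re, I_re, mul_zero, ofReal_im, I_im, mul_one, sub_self,
      add_zero, add_im, mul_im, zero_add, smul_eq_mul] at key
    have hside : ∀ (γ : ℝ → ℂ) (p q : ℝ), p ≤ q → Continuous γ → (∀ t ∈ Icc p q, γ t ≠ w) →
        (∀ t ∈ Icc p q, DifferentiableAt ℂ φ (γ t)) →
        ∫ t in p..q, dslope φ w (γ t) =
          (∫ t in p..q, (γ t - w)⁻¹ * φ (γ t)) - (∫ t in p..q, (γ t - w)⁻¹) * φ w := by
      intro γ p q hpq hγ hne hd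
      have hi : ContinuousOn (fun t ↦ (γ t - w)⁻¹) (uIcc p q) := by
        rw [uIcc_of_le hpq]
        exact (hγ.continuousOn.sub continuousOn_const).inv₀ fun t ht ↦ sub_ne_zero.2 (hne t ht)
      have hf : ContinuousOn (fun t ↦ φ (γ t)) (uIcc p q) := by
        rw [uIcc_of_le hpq]
        exact fun t ht ↦ ((hd t ht).continuousAt.comp hγ.continuousAt).continuousWithinAt
      have hi₁ : IntervalIntegrable (fun t ↦ (γ t - w)⁻¹ * φ (γ t)) volume p q :=
        (hi.mul hf).intervalIntegrable
      have hi₂ : IntervalIntegrable (fun t ↦ (γ t - w)⁻¹ * φ w) volume p q :=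
        (hi.mul continuousOn_const).intervalIntegrable
      rw [← intervalIntegral.integral_mul_const, ← intervalIntegral.integral_sub hi₁ hi₂]
      refine intervalIntegral.integral_congr fun t ht ↦ ?_
      rw [uIcc_of_le hpq] at ht
      simp only [dslope_of_ne φ (hne t ht), slope_def_field]
      ring
    have hne_im : ∀ ζ : ℂ, ζ.im ≠ w.im → ζ ≠ w := fun ζ h h' ↦ h (by rw [h'])
    have hne_re : ∀ ζ : ℂ, ζ.re ≠ w.re → ζ ≠ w := fun ζ h h' ↦ h (by rw [h'])
    rw [hside (fun x ↦ x + y₀ * I) x₀ x₁ hx (by fun_prop)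
        (fun t _ ↦ hne_im _ (by simp [hy₀.ne])) (fun t ht ↦ hφ _ (by simpa using ht) (by simpa)),
      hside (fun x ↦ x + y₁ * I) x₀ x₁ hx (by fun_prop)
        (fun t _ ↦ hne_im _ (by simp [hy₁.ne'])) (fun t ht ↦ hφ _ (by simpa using ht) (by simpa)),
      hside (fun y ↦ x₁ + y * I) y₀ y₁ hy (by fun_prop)
        (fun t _ ↦ hne_re _ (by simp [hx₁.ne'])) (fun t ht ↦ hφ _ (by simpa) (by simpa using ht)),
      hside (fun y ↦ x₀ + y * I) y₀ y₁ hy (by fun_prop)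
        (fun t _ ↦ hne_re _ (by simp [hx₀.ne])) (fun t ht ↦ hφ _ (by simpa) (by simpa using ht))]
      at key
    linear_combination key + φ w * integral_boundary_rect_inv_sub hx₀ hx₁ hy₀ hy₁
  · have hw : ((Icc x₀ x₁) ×ℂ (Icc y₀ y₁)) ∈ 𝓝 w :=
      mem_of_superset ((isOpen_Ioo.reProdIm isOpen_Ioo).mem_nhds
        (show w ∈ Ioo x₀ x₁ ×ℂ Ioo y₀ y₁ from ⟨⟨hx₀, hx₁⟩, ⟨hy₀, hy₁⟩⟩))
        (inter_subset_inter (preimage_mono Ioo_subset_Icc_self)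
          (preimage_mono Ioo_subset_Icc_self))
    simp only [add_re, ofReal_re, mul_re, I_re, mul_zero, ofReal_im, I_im, mul_one, sub_self,
      add_zero, add_im, mul_im, zero_add, uIcc_of_le hx, uIcc_of_le hy]
    rw [continuousOn_dslope hw]
    exact ⟨fun ζ hζ ↦ (hφ ζ hζ.1 hζ.2).continuousAt.continuousWithinAt,
      hφ w ⟨hx₀.le, hx₁.le⟩ ⟨hy₀.le, hy₁.le⟩⟩
  · intro ζ hζ
    simp only [add_re, ofReal_re, mul_re, I_re, mul_zero, ofReal_im, I_im, mul_one, sub_self,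
      add_zero, add_im, mul_im, zero_add, min_eq_left hx, min_eq_left hy, max_eq_right hx,
      max_eq_right hy] at hζ
    exact (differentiableAt_dslope_of_ne hζ.2).2
      (hφ ζ (Ioo_subset_Icc_self hζ.1.1) (Ioo_subset_Icc_self hζ.1.2))

/-- A neighborhood of a vertical segment contains a closed rectangle around it. -/
theorem exists_rect_subset_of_isOpen {O : Set ℂ} {s c d : ℝ} (hcd : c ≤ d) (hO : IsOpen O)
    (h : ∀ ζ : ℂ, ζ.re = s → ζ.im ∈ Icc c d → ζ ∈ O) :
    ∃ η > 0, ∀ ζ : ℂ, ζ.re ∈ Icc (s - η) (s + η) → ζ.im ∈ Icc (c - η) (d + η) → ζ ∈ O := by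
  obtain ⟨δ, hδ, hδO⟩ := ((isCompact_singleton (x := s)).reProdIm
    (isCompact_Icc (a := c) (b := d))).exists_thickening_subset_open hO fun ζ hζ ↦ h ζ hζ.1 hζ.2
  refine ⟨δ / 4, by positivity, fun ζ hre him ↦ hδO ?_⟩
  refine mem_thickening_iff.2 ⟨⟨s, max c (min d ζ.im)⟩, ⟨rfl, ?_⟩, ?_⟩
  · exact ⟨le_max_left _ _, max_le hcd (min_le_left _ _)⟩
  · rw [dist_eq_norm]
    refine (norm_le_abs_re_add_abs_im _).trans_lt ?_
    have h1 : |ζ.re - s| ≤ δ / 4 := abs_le.2 ⟨by linarith [hre.1], by linarith [hre.2]⟩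
    have h2 : |ζ.im - max c (min d ζ.im)| ≤ δ / 4 := by
      rw [abs_le]
      obtain ⟨h3, h4⟩ := him
      rcases le_total d ζ.im with h5 | h5 <;> rcases le_total c ζ.im with h6 | h6 <;>
        simp only [min_eq_left, min_eq_right, max_eq_left, max_eq_right, hcd, h5, h6] <;>
        constructor <;> linarith
    simp only [sub_re, sub_im]
    linarith

/-- **Cousin decomposition**: if a compact set `K` is cut along `re ℓ = s`, a holomorphic function
near the cut is a difference of functions holomorphic near the two parts of `K`. -/
theorem exists_cousin_decomposition {E : Type*} [NormedAddCommGroup E] [NormedSpace ℂ E]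
    [ProperSpace E] {K U : Set E} (hK : IsCompact K) (hU : IsOpen U) (ℓ : E →L[ℂ] ℂ) (e : E)
    {s c d : ℝ} (him : ∀ k ∈ K, (ℓ k).im ∈ Icc c d)
    (hcut : ∀ k ∈ K, ∀ ζ : ℂ, ζ.re = s → ζ.im ∈ Icc c d → k + (ζ - ℓ k) • e ∈ U) :
    ∃ V₁ V₂ : Set E, IsOpen V₁ ∧ IsOpen V₂ ∧ K ∩ {z | (ℓ z).re ≤ s} ⊆ V₁ ∧
      K ∩ {z | s ≤ (ℓ z).re} ⊆ V₂ ∧ V₁ ∩ V₂ ⊆ U ∧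
      ∀ h : E → ℂ, DifferentiableOn ℂ h U → ∃ h₁ h₂ : E → ℂ, DifferentiableOn ℂ h₁ V₁ ∧
        DifferentiableOn ℂ h₂ V₂ ∧ ∀ z ∈ V₁ ∩ V₂, h z = h₁ z - h₂ z := by
  rcases K.eq_empty_or_nonempty with rfl | ⟨k₀, hk₀⟩
  · exact ⟨∅, ∅, isOpen_empty, isOpen_empty, by simp, by simp, by simp,
      fun h _ ↦ ⟨h, h, differentiableOn_empty, differentiableOn_empty, by simp⟩⟩
  have hcd : c ≤ d := (him k₀ hk₀).1.trans (him k₀ hk₀).2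
  obtain ⟨W, O, hW, hO, hKW, hRO, hWO⟩ := generalized_tube_lemma hK
    ((isCompact_singleton (x := s)).reProdIm (isCompact_Icc (a := c) (b := d)))
    (hU.preimage (show Continuous fun x : E × ℂ ↦ x.1 + (x.2 - ℓ x.1) • e by fun_prop))
    (fun x hx ↦ hcut x.1 hx.1 x.2 hx.2.1 hx.2.2)
  obtain ⟨η, hη, hηO⟩ := exists_rect_subset_of_isOpen hcd hO fun ζ h1 h2 ↦ hRO ⟨h1, h2⟩
  have hmem : ∀ z ∈ W, ∀ ζ : ℂ, ζ.re ∈ Icc (s - η) (s + η) → ζ.im ∈ Icc (c - η) (d + η) →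
      z + (ζ - ℓ z) • e ∈ U := fun z hz ζ h1 h2 ↦ hWO (mk_mem_prod hz (hηO ζ h1 h2))
  let S : Set E := W ∩ {z | c - η < (ℓ z).im ∧ (ℓ z).im < d + η}
  have hS : IsOpen S := by
    refine hW.inter (IsOpen.inter (s := {z | c - η < (ℓ z).im}) (t := {z | (ℓ z).im < d + η}) ?_ ?_)
    · exact isOpen_lt (by fun_prop) (by fun_prop)
    · exact isOpen_lt (by fun_prop) (by fun_prop)
  have hKS : K ⊆ S := fun k hk ↦
    ⟨hKW hk, by linarith [(him k hk).1], by linarith [(him k hk).2]⟩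
  have hV₁ : IsOpen (S ∩ {z | (ℓ z).re < s + η}) :=
    hS.inter (isOpen_lt (by fun_prop) (by fun_prop))
  have hV₂ : IsOpen (S ∩ {z | s - η < (ℓ z).re}) :=
    hS.inter (isOpen_lt (by fun_prop) (by fun_prop))
  refine ⟨S ∩ {z | (ℓ z).re < s + η}, S ∩ {z | s - η < (ℓ z).re}, hV₁, hV₂, ?_, ?_, ?_, ?_⟩
  · exact fun z hz ↦ ⟨hKS hz.1, (show (ℓ z).re ≤ s from hz.2).trans_lt (by linarith)⟩
  · exact fun z hz ↦ ⟨hKS hz.1, (show s - η < s by linarith).trans_le hz.2⟩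
  · rintro z ⟨⟨hz, h1⟩, -, h2⟩
    simpa using hmem z hz.1 (ℓ z) ⟨le_of_lt h2, le_of_lt h1⟩ ⟨hz.2.1.le, hz.2.2.le⟩
  intro h hh
  have hside : ∀ (γ : ℝ → ℂ) (p q : ℝ) (V : Set E), p ≤ q → Continuous γ → IsOpen V → V ⊆ W →
      (∀ t ∈ Icc p q, (γ t).re ∈ Icc (s - η) (s + η) ∧ (γ t).im ∈ Icc (c - η) (d + η)) →
      (∀ z ∈ V, ∀ t ∈ Icc p q, γ t ≠ ℓ z) →
      DifferentiableOn ℂ (fun z ↦ ∫ t in p..q, (γ t - ℓ z)⁻¹ * h (z + (γ t - ℓ z) • e)) V := by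
    intro γ p q V hpq hγ hV hVW hrect hne
    refine differentiableOn_intervalIntegral hV ?_ ?_
    · rw [uIcc_of_le hpq]
      refine ContinuousOn.mul ?_ ?_
      · exact ContinuousOn.inv₀ (by fun_prop) fun x hx ↦ sub_ne_zero.2 (hne x.1 hx.1 x.2 hx.2)
      · exact hh.continuousOn.comp (by fun_prop) fun x hx ↦
          hmem x.1 (hVW hx.1) _ (hrect x.2 hx.2).1 (hrect x.2 hx.2).2
    · rw [uIcc_of_le hpq]
      intro t ht
      refine DifferentiableOn.mul ?_ ?_
      · exact DifferentiableOn.inv (by fun_prop) fun z hz ↦ sub_ne_zero.2 (hne z hz t ht)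
      · exact hh.comp (by fun_prop) fun z hz ↦ hmem z (hVW hz) _ (hrect t ht).1 (hrect t ht).2
  have hne_im : ∀ ζ w : ℂ, ζ.im ≠ w.im → ζ ≠ w := fun ζ w h h' ↦ h (by rw [h'])
  have hne_re : ∀ ζ w : ℂ, ζ.re ≠ w.re → ζ ≠ w := fun ζ w h h' ↦ h (by rw [h'])
  have h_re : ∀ x y : ℝ, ((x : ℂ) + y * I).re = x := fun x y ↦ by simp
  have h_im : ∀ x y : ℝ, ((x : ℂ) + y * I).im = y := fun x y ↦ by simp
  have hxx : s - η ≤ s + η := by linarith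
  have hyy : c - η ≤ d + η := by linarith
  have hbot := hside (fun x ↦ x + (c - η : ℝ) * I) (s - η) (s + η) _ hxx (by fun_prop) hV₁
    (fun z hz ↦ hz.1.1) (fun t ht ↦ by rw [h_re, h_im]; exact ⟨ht, left_mem_Icc.2 hyy⟩)
    (fun z hz t _ ↦ hne_im _ _ (by simpa using hz.1.2.1.ne))
  have htop := hside (fun x ↦ x + (d + η : ℝ) * I) (s - η) (s + η) _ hxx (by fun_prop) hV₁
    (fun z hz ↦ hz.1.1) (fun t ht ↦ by rw [h_re, h_im]; exact ⟨ht, right_mem_Icc.2 hyy⟩)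
    (fun z hz t _ ↦ hne_im _ _ (by simpa using hz.1.2.2.ne'))
  have hright := hside (fun y ↦ (s + η : ℝ) + y * I) (c - η) (d + η) _ hyy (by fun_prop) hV₁
    (fun z hz ↦ hz.1.1) (fun t ht ↦ by rw [h_re, h_im]; exact ⟨right_mem_Icc.2 hxx, ht⟩)
    (fun z hz t _ ↦ hne_re _ _ (by simpa using (ne_of_lt hz.2).symm))
  have hleft := hside (fun y ↦ (s - η : ℝ) + y * I) (c - η) (d + η) _ hyy (by fun_prop) hV₂
    (fun z hz ↦ hz.1.1) (fun t ht ↦ by rw [h_re, h_im]; exact ⟨left_mem_Icc.2 hxx, ht⟩)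
    (fun z hz t _ ↦ hne_re _ _ (by simpa using (ne_of_lt hz.2)))
  refine ⟨_, _, ((hbot.sub htop).add (hright.const_mul I)).const_mul (2 * Real.pi * I)⁻¹,
    (hleft.const_mul I).const_mul (2 * Real.pi * I)⁻¹, ?_⟩
  rintro z ⟨⟨hz, h1⟩, -, h2⟩
  have key := integral_boundary_rect_inv_sub_mul (w := ℓ z)
    (φ := fun ζ ↦ h (z + (ζ - ℓ z) • e)) h2 h1 hz.2.1 hz.2.2 fun ζ hζ₁ hζ₂ ↦
      (hh.differentiableAt (hU.mem_nhds (hmem z hz.1 ζ hζ₁ hζ₂))).comp ζ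
        (by fun_prop : DifferentiableAt ℂ (fun ζ : ℂ ↦ z + (ζ - ℓ z) • e) ζ)
  simp only [sub_self, zero_smul, add_zero] at key
  rw [← mul_sub]
  refine (eq_inv_mul_iff_mul_eq₀ two_pi_I_ne_zero).2 key.symm

/-- Cartan's Bézout equation `∑ j, g j * f j = 1` is solvable near a set. -/
def HasBezoutNear {E ι : Type*} [NormedAddCommGroup E] [NormedSpace ℂ E] [Fintype ι]
    (f : ι → E → ℂ) (K : Set E) : Prop :=
  ∃ U : Set E, IsOpen U ∧ K ⊆ U ∧ ∃ g : ι → E → ℂ, (∀ j, DifferentiableOn ℂ (g j) U) ∧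
    ∀ z ∈ U, ∑ j, g j z * f j z = 1

theorem HasBezoutNear.mono {E ι : Type*} [NormedAddCommGroup E] [NormedSpace ℂ E] [Fintype ι]
    {f : ι → E → ℂ} {K L : Set E} (h : HasBezoutNear f L) (hKL : K ⊆ L) : HasBezoutNear f K :=
  let ⟨U, hU, hLU, hg⟩ := h
  ⟨U, hU, hKL.trans hLU, hg⟩

/-- A skew-symmetric matrix annihilates a vector in the sense of its quadratic form. -/
theorem sum_sum_sub_mul_mul_eq_zero {ι R : Type*} [Fintype ι] [CommRing R] (q : ι → ι → R)
    (f : ι → R) : ∑ j, (∑ k, (q j k - q k j) * f k) * f j = 0 := by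
  simp only [Finset.sum_mul, sub_mul, Finset.sum_sub_distrib]
  rw [sub_eq_zero, Finset.sum_comm]
  exact Finset.sum_congr rfl fun _ _ ↦ Finset.sum_congr rfl fun _ _ ↦ by ring

/-- Exactness of the Koszul complex of a unimodular row: the difference of two solutions of the
Bézout equation comes from a skew-symmetric matrix. -/
theorem sub_eq_sum_koszul {ι R : Type*} [Fintype ι] [CommRing R] {f g g' : ι → R}
    (hg : ∑ j, g j * f j = 1) (hg' : ∑ j, g' j * f j = 1) (j : ι) :
    g' j - g j = ∑ k, ((g' j - g j) * g k - (g' k - g k) * g j) * f k := by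
  have : ∀ k, ((g' j - g j) * g k - (g' k - g k) * g j) * f k =
      g' j * (g k * f k) - g j * (g' k * f k) := fun k ↦ by ring
  simp only [this, Finset.sum_sub_distrib, ← Finset.mul_sum, hg, hg', mul_one]

/-- Solutions of the Bézout equation near the two parts of a compact set cut along `re ℓ = s`
can be glued. -/
theorem HasBezoutNear.of_cut {E ι : Type*} [NormedAddCommGroup E] [NormedSpace ℂ E]
    [ProperSpace E] [Fintype ι] {f : ι → E → ℂ} (hf : ∀ j, Differentiable ℂ (f j)) {K : Set E}
    (hK : IsCompact K) (ℓ : E →L[ℂ] ℂ) {e : E} (he : ℓ e = 1) {s c d : ℝ}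
    (him : ∀ k ∈ K, (ℓ k).im ∈ Icc c d)
    (hcut : ∀ k ∈ K, ∀ ζ : ℂ, ζ.re = s → ζ.im ∈ Icc c d → k + (ζ - ℓ k) • e ∈ K)
    (h₁ : HasBezoutNear f (K ∩ {z | (ℓ z).re ≤ s}))
    (h₂ : HasBezoutNear f (K ∩ {z | s ≤ (ℓ z).re})) : HasBezoutNear f K := by
  classical
  obtain ⟨U₁, hU₁, hKU₁, g₁, hg₁, hs₁⟩ := h₁
  obtain ⟨U₂, hU₂, hKU₂, g₂, hg₂, hs₂⟩ := h₂
  obtain ⟨V₁, V₂, hV₁, hV₂, hKV₁, hKV₂, hVU, hsplit⟩ :=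
    exists_cousin_decomposition hK (hU₁.inter hU₂) ℓ e him fun k hk ζ hζ₁ hζ₂ ↦ by
      have hm := hcut k hk ζ hζ₁ hζ₂
      have hℓ : (ℓ (k + (ζ - ℓ k) • e)).re = s := by simp [he, hζ₁]
      exact ⟨hKU₁ ⟨hm, hℓ.le⟩, hKU₂ ⟨hm, hℓ.ge⟩⟩
  have hq : ∀ j k, ∃ q₁ q₂ : E → ℂ, DifferentiableOn ℂ q₁ V₁ ∧ DifferentiableOn ℂ q₂ V₂ ∧
      ∀ z ∈ V₁ ∩ V₂, (g₂ j z - g₁ j z) * g₁ k z = q₁ z - q₂ z := fun j k ↦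
    hsplit _ ((((hg₂ j).mono inter_subset_right).sub ((hg₁ j).mono inter_subset_left)).mul
      ((hg₁ k).mono inter_subset_left))
  choose q₁ q₂ hq₁ hq₂ hq₁₂ using hq
  let G₁ : ι → E → ℂ := fun j z ↦ g₁ j z + ∑ k, (q₁ j k z - q₁ k j z) * f k z
  let G₂ : ι → E → ℂ := fun j z ↦ g₂ j z + ∑ k, (q₂ j k z - q₂ k j z) * f k z
  have hG₁ : ∀ j, DifferentiableOn ℂ (G₁ j) (V₁ ∩ U₁) := fun j ↦
    ((hg₁ j).mono inter_subset_right).add (DifferentiableOn.fun_sum fun k _ ↦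
      (((hq₁ j k).sub (hq₁ k j)).mono inter_subset_left).mul (hf k).differentiableOn)
  have hG₂ : ∀ j, DifferentiableOn ℂ (G₂ j) (V₂ ∩ U₂) := fun j ↦
    ((hg₂ j).mono inter_subset_right).add (DifferentiableOn.fun_sum fun k _ ↦
      (((hq₂ j k).sub (hq₂ k j)).mono inter_subset_left).mul (hf k).differentiableOn)
  have hs₁' : ∀ z ∈ V₁ ∩ U₁, ∑ j, G₁ j z * f j z = 1 := fun z hz ↦ by
    simp only [G₁, add_mul, Finset.sum_add_distrib, hs₁ z hz.2,
      sum_sum_sub_mul_mul_eq_zero (fun j k ↦ q₁ j k z), add_zero]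
  have hs₂' : ∀ z ∈ V₂ ∩ U₂, ∑ j, G₂ j z * f j z = 1 := fun z hz ↦ by
    simp only [G₂, add_mul, Finset.sum_add_distrib, hs₂ z hz.2,
      sum_sum_sub_mul_mul_eq_zero (fun j k ↦ q₂ j k z), add_zero]
  have hagree : ∀ j, ∀ z ∈ V₁ ∩ U₁, z ∈ V₂ ∩ U₂ → G₁ j z = G₂ j z := by
    intro j z hz hz'
    have hk := sub_eq_sum_koszul (hs₁ z hz.2) (hs₂ z hz'.2) j
    have : ∀ k, ((g₂ j z - g₁ j z) * g₁ k z - (g₂ k z - g₁ k z) * g₁ j z) * f k z =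
        (q₁ j k z - q₁ k j z) * f k z - (q₂ j k z - q₂ k j z) * f k z := fun k ↦ by
      rw [hq₁₂ j k z ⟨hz.1, hz'.1⟩, hq₁₂ k j z ⟨hz.1, hz'.1⟩]
      ring
    simp only [this, Finset.sum_sub_distrib] at hk
    simp only [G₁, G₂]
    linear_combination -hk
  refine ⟨(V₁ ∩ U₁) ∪ (V₂ ∩ U₂), (hV₁.inter hU₁).union (hV₂.inter hU₂), fun z hz ↦ ?_,
    fun j ↦ (V₁ ∩ U₁).piecewise (G₁ j) (G₂ j), fun j z hz ↦ ?_, fun z hz ↦ ?_⟩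
  · rcases le_total (ℓ z).re s with h | h
    · exact Or.inl ⟨hKV₁ ⟨hz, h⟩, hKU₁ ⟨hz, h⟩⟩
    · exact Or.inr ⟨hKV₂ ⟨hz, h⟩, hKU₂ ⟨hz, h⟩⟩
  · refine DifferentiableAt.differentiableWithinAt ?_
    rcases hz with hz | hz
    · refine ((hG₁ j).differentiableAt ((hV₁.inter hU₁).mem_nhds hz)).congr_of_eventuallyEq ?_
      filter_upwards [(hV₁.inter hU₁).mem_nhds hz] with w hw
      exact piecewise_eq_of_mem _ _ _ hw
    · refine ((hG₂ j).differentiableAt ((hV₂.inter hU₂).mem_nhds hz)).congr_of_eventuallyEq ?_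
      filter_upwards [(hV₂.inter hU₂).mem_nhds hz] with w hw
      by_cases hw' : w ∈ V₁ ∩ U₁
      · rw [piecewise_eq_of_mem _ _ _ hw', hagree j w hw' hw]
      · exact piecewise_eq_of_notMem _ _ _ hw'
  · by_cases hz' : z ∈ V₁ ∩ U₁
    · simp only [piecewise_eq_of_mem _ _ _ hz', hs₁' z hz']
    · simp only [piecewise_eq_of_notMem _ _ _ hz', hs₂' z (hz.resolve_left hz')]

/-- The closed box in `ℂⁿ` with lower and upper bounds `a` and `b` for the real coordinates: the
index `(i, false)` stands for the real part and `(i, true)` for the imaginary part of `z i`. -/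
def complexBox {n : ℕ} (a b : Fin n × Bool → ℝ) : Set (Fin n → ℂ) :=
  {z | ∀ i, (z i).re ∈ Icc (a (i, false)) (b (i, false)) ∧
    (z i).im ∈ Icc (a (i, true)) (b (i, true))}

theorem isCompact_complexBox {n : ℕ} (a b : Fin n × Bool → ℝ) : IsCompact (complexBox a b) := by
  have : complexBox a b = pi univ fun i ↦ Icc (a (i, false)) (b (i, false)) ×ℂ
      Icc (a (i, true)) (b (i, true)) := by
    ext z
    simp [complexBox, mem_reProdIm]
  rw [this]
  exact isCompact_univ_pi fun i ↦ isCompact_Icc.reProdIm isCompact_Icc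

theorem complexBox_mono {n : ℕ} {a b a' b' : Fin n × Bool → ℝ} (ha : ∀ c, a' c ≤ a c)
    (hb : ∀ c, b c ≤ b' c) : complexBox a b ⊆ complexBox a' b' := fun _ hz i ↦
  ⟨Icc_subset_Icc (ha _) (hb _) (hz i).1, Icc_subset_Icc (ha _) (hb _) (hz i).2⟩

/-- Solutions of the Bézout equation near the two parts of a box can be glued. -/
theorem HasBezoutNear.complexBox {n : ℕ} {ι : Type*} [Fintype ι] {f : ι → (Fin n → ℂ) → ℂ}
    (hf : ∀ j, Differentiable ℂ (f j)) {a b : Fin n × Bool → ℝ} (c : Fin n × Bool) (s : ℝ)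
    (h₁ : HasBezoutNear f (complexBox a (Function.update b c s)))
    (h₂ : HasBezoutNear f (complexBox (Function.update a c s) b)) :
    HasBezoutNear f (complexBox a b) := by
  by_cases hsa : s < a c
  · refine h₂.mono (complexBox_mono (fun c' ↦ ?_) fun _ ↦ le_rfl)
    rcases eq_or_ne c' c with rfl | h
    · simpa using hsa.le
    · simp [h]
  by_cases hsb : b c < s
  · refine h₁.mono (complexBox_mono (fun _ ↦ le_rfl) fun c' ↦ ?_)
    rcases eq_or_ne c' c with rfl | h
    · simpa using hsb.le
    · simp [h]
  rw [not_lt] at hsa hsb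
  obtain ⟨i, _ | _⟩ := c
  · refine HasBezoutNear.of_cut hf (isCompact_complexBox a b) (ContinuousLinearMap.proj i)
      (e := Pi.single i 1) (s := s) (c := a (i, true)) (d := b (i, true)) (by simp)
      (fun k hk ↦ (hk i).2) (fun k hk ζ hre him i' ↦ ?_) (h₁.mono fun z hz i' ↦ ?_)
      (h₂.mono fun z hz i' ↦ ?_)
    · rcases eq_or_ne i' i with rfl | h
      · simpa [hre] using ⟨⟨hsa, hsb⟩, him⟩
      · simpa [h] using hk i'
    · have hs : (z i).re ≤ s := hz.2
      rcases eq_or_ne i' i with rfl | h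
      · simpa [hs] using ⟨(hz.1 i').1.1, (hz.1 i').2⟩
      · simpa [h] using hz.1 i'
    · have hs : s ≤ (z i).re := hz.2
      rcases eq_or_ne i' i with rfl | h
      · simpa [hs] using ⟨(hz.1 i').1.2, (hz.1 i').2⟩
      · simpa [h] using hz.1 i'
  · refine HasBezoutNear.of_cut hf (isCompact_complexBox a b)
      ((-I) • ContinuousLinearMap.proj (R := ℂ) (φ := fun _ : Fin n ↦ ℂ) i)
      (e := Pi.single i I) (s := s) (c := -b (i, false)) (d := -a (i, false)) (by simp)
      (fun k hk ↦ ?_) (fun k hk ζ hre him i' ↦ ?_) (h₁.mono fun z hz i' ↦ ?_)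
      (h₂.mono fun z hz i' ↦ ?_)
    · simpa [and_comm] using (hk i).1
    · rcases eq_or_ne i' i with rfl | h
      · simpa [hre] using ⟨⟨le_neg.1 him.2, neg_le.1 him.1⟩, hsa, hsb⟩
      · simpa [h] using hk i'
    · have hs : (z i).im ≤ s := by simpa using hz.2
      rcases eq_or_ne i' i with rfl | h
      · simpa [hs] using ⟨(hz.1 i').1, (hz.1 i').2.1⟩
      · simpa [h] using hz.1 i'
    · have hs : s ≤ (z i).im := by simpa using hz.2
      rcases eq_or_ne i' i with rfl | h
      · simpa [hs] using ⟨(hz.1 i').1, (hz.1 i').2.2⟩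
      · simpa [h] using hz.1 i'

theorem hasBezoutNear_setOf_ne_zero {E ι : Type*} [NormedAddCommGroup E] [NormedSpace ℂ E]
    [Fintype ι] {f : ι → E → ℂ} (hf : ∀ j, Differentiable ℂ (f j)) (j : ι) :
    HasBezoutNear f {z | f j z ≠ 0} := by
  classical
  refine ⟨_, isOpen_ne_fun (hf j).continuous continuous_const, subset_rfl,
    fun k z ↦ if k = j then (f j z)⁻¹ else 0, fun k ↦ ?_, fun z hz ↦ ?_⟩
  · by_cases hk : k = j
    · simp only [hk, if_true]
      exact (hf j).differentiableOn.fun_inv fun z hz ↦ hz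
    · simp only [hk, if_false]
      exact differentiableOn_const 0
  · simpa using inv_mul_cancel₀ hz

/-- The Bézout equation is solvable near a box if there is no common zero. -/
theorem hasBezoutNear_complexBox {n : ℕ} {ι : Type*} [Fintype ι] {f : ι → (Fin n → ℂ) → ℂ}
    (hf : ∀ j, Differentiable ℂ (f j)) (h0 : ∀ z, ∃ j, f j z ≠ 0) (a b : Fin n × Bool → ℝ) :
    HasBezoutNear f (complexBox a b) := by
  obtain ⟨δ, hδ, hball⟩ := lebesgue_number_lemma_of_metric (isCompact_complexBox a b)
    (c := fun j ↦ {z | f j z ≠ 0}) (fun j ↦ isOpen_ne_fun (hf j).continuous continuous_const)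
    fun z _ ↦ mem_iUnion.2 (h0 z)
  have key : ∀ (m : ℕ) (k : Fin n × Bool → ℕ) (a' b' : Fin n × Bool → ℝ), ∑ c, k c < m →
      (∀ c, a c ≤ a' c) → (∀ c, b' c ≤ b c) → (∀ c, b' c - a' c ≤ k c * (δ / 4)) →
      HasBezoutNear f (complexBox a' b') := by
    intro m
    induction m with
    | zero => exact fun k _ _ hk ↦ absurd hk (Nat.not_lt_zero _)
    | succ m ih =>
      intro k a' b' hk ha hb hab
      by_cases hsmall : ∀ c, b' c - a' c ≤ δ / 4
      · rcases (complexBox a' b').eq_empty_or_nonempty with h | ⟨x, hx⟩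
        · rw [h]
          exact ⟨∅, isOpen_empty, subset_rfl, 0, by simp, by simp⟩
        · obtain ⟨j, hj⟩ := hball x (complexBox_mono ha hb hx)
          refine (hasBezoutNear_setOf_ne_zero hf j).mono (Subset.trans (fun z hz ↦ ?_) hj)
          rw [mem_ball, dist_pi_lt_iff hδ]
          intro i
          rw [dist_eq_norm]
          have h_re : |(z i - x i).re| ≤ δ / 4 := by
            rw [sub_re, abs_le]
            have h := hsmall (i, false)
            constructor <;> linarith [(hz i).1.1, (hz i).1.2, (hx i).1.1, (hx i).1.2]
          have h_im : |(z i - x i).im| ≤ δ / 4 := by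
            rw [sub_im, abs_le]
            have h := hsmall (i, true)
            constructor <;> linarith [(hz i).2.1, (hz i).2.2, (hx i).2.1, (hx i).2.2]
          linarith [norm_le_abs_re_add_abs_im (z i - x i)]
      · push Not at hsmall
        obtain ⟨c, hc⟩ := hsmall
        have hkc : 1 < k c := by
          by_contra! h
          have h' : (k c : ℝ) ≤ 1 := by exact_mod_cast h
          nlinarith [hab c]
        have hlt : ∀ l < k c, ∑ c', Function.update k c l c' < m := fun l hl ↦ by
          refine lt_of_lt_of_le (Finset.sum_lt_sum (fun c' _ ↦ ?_) ⟨c, Finset.mem_univ _, ?_⟩)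
            (Nat.le_of_lt_succ hk)
          · rcases eq_or_ne c' c with rfl | h
            · simpa using hl.le
            · simp [h]
          · simpa using hl
        refine HasBezoutNear.complexBox hf c (a' c + δ / 4)
          (ih (Function.update k c 1) _ _ (hlt 1 hkc) ha (fun c' ↦ ?_) fun c' ↦ ?_)
          (ih (Function.update k c (k c - 1)) _ _ (hlt _ (by lia)) (fun c' ↦ ?_) hb fun c' ↦ ?_)
        · rcases eq_or_ne c' c with rfl | h
          · simp only [Function.update_self]
            linarith [hb c']
          · simpa [h] using hb c'
        · rcases eq_or_ne c' c with rfl | h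
          · simp
          · simpa [h] using hab c'
        · rcases eq_or_ne c' c with rfl | h
          · simp only [Function.update_self]
            linarith [ha c']
          · simpa [h] using ha c'
        · rcases eq_or_ne c' c with rfl | h
          · simp only [Function.update_self]
            rw [Nat.cast_sub hkc.le, Nat.cast_one]
            linarith [hab c']
          · simpa [h] using hab c'
  refine key _ (fun c ↦ ⌈(b c - a c) / (δ / 4)⌉₊) a b (Nat.lt_succ_self _) (fun _ ↦ le_rfl)
    (fun _ ↦ le_rfl) fun c ↦ ?_
  rw [← div_le_iff₀ (by positivity)]
  exact Nat.le_ceil _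

/-- The Bézout equation is solvable on every ball if there is no common zero. -/
theorem exists_bezout_on_ball {n : ℕ} {ι : Type*} [Fintype ι] {f : ι → (Fin n → ℂ) → ℂ}
    (hf : ∀ j, Differentiable ℂ (f j)) (h0 : ∀ z, ∃ j, f j z ≠ 0) (R : ℝ) :
    ∃ g : ι → (Fin n → ℂ) → ℂ, (∀ j, DifferentiableOn ℂ (g j) (ball 0 R)) ∧
      ∀ z ∈ ball 0 R, ∑ j, g j z * f j z = 1 := by
  obtain ⟨U, -, hU, g, hg, h1⟩ := hasBezoutNear_complexBox hf h0 (fun _ ↦ -R) fun _ ↦ R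
  have hsub : ball 0 R ⊆ U := fun z hz ↦ hU fun i ↦ by
    have hz' := (norm_le_pi_norm z i).trans (mem_ball_zero_iff.1 hz).le
    exact ⟨abs_le.1 ((abs_re_le_norm _).trans hz'), abs_le.1 ((abs_im_le_norm _).trans hz')⟩
  exact ⟨g, fun j ↦ (hg j).mono hsub, fun z hz ↦ h1 z (hsub hz)⟩

/-- A solution of the Bézout equation on a ball can be approximated on a smaller ball by
solutions on any ball on which the equation is solvable. -/
theorem exists_bezout_approx {E ι : Type*} [NormedAddCommGroup E] [NormedSpace ℂ E]
    [ProperSpace E] [Fintype ι] {f g h : ι → E → ℂ} {r R R' ε : ℝ}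
    (hf : ∀ j, Differentiable ℂ (f j)) (hr : 0 < r) (hrR : r < R) (hRR' : R ≤ R') (hε : 0 < ε)
    (hg : ∀ j, DifferentiableOn ℂ (g j) (ball 0 R))
    (hg1 : ∀ z ∈ ball 0 R, ∑ j, g j z * f j z = 1)
    (hh : ∀ j, DifferentiableOn ℂ (h j) (ball 0 R'))
    (hh1 : ∀ z ∈ ball 0 R', ∑ j, h j z * f j z = 1) :
    ∃ g' : ι → E → ℂ, (∀ j, DifferentiableOn ℂ (g' j) (ball 0 R')) ∧
      (∀ z ∈ ball 0 R', ∑ j, g' j z * f j z = 1) ∧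
      ∀ j, ∀ z ∈ ball 0 r, ‖g' j z - g j z‖ ≤ ε := by
  have hsub : ball (0 : E) R ⊆ ball 0 R' := ball_subset_ball hRR'
  choose C hC using fun j ↦
    (isCompact_closedBall (0 : E) r).exists_bound_of_continuousOn (hf j).continuous.continuousOn
  have hC0 : ∀ j, 0 ≤ C j := fun j ↦
    (norm_nonneg _).trans (hC j 0 (mem_closedBall_self hr.le))
  set S := ∑ j, C j
  have hS0 : 0 ≤ S := Finset.sum_nonneg fun j _ ↦ hC0 j
  have hη : 0 < ε / (2 * (S + 1)) := by positivity
  choose p hp hpa using fun j k ↦ exists_entire_approx hr hrR hη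
    (((hh j).mono hsub |>.sub (hg j)).mul (hg k))
  refine ⟨fun j z ↦ h j z - ∑ k, (p j k z - p k j z) * f k z, fun j ↦ ?_, fun z hz ↦ ?_,
    fun j z hz ↦ ?_⟩
  · exact (hh j).sub (DifferentiableOn.fun_sum fun k _ ↦
      (((hp j k).sub (hp k j)).mul (hf k)).differentiableOn)
  · simp only [sub_mul, Finset.sum_sub_distrib]
    have := sum_sum_sub_mul_mul_eq_zero (fun j k ↦ p j k z) fun j ↦ f j z
    simp only [sub_mul, Finset.sum_sub_distrib] at this
    rw [this, hh1 z hz, sub_zero]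
  · have hzR := ball_subset_ball hrR.le hz
    have hk := sub_eq_sum_koszul (hg1 z hzR) (hh1 z (hsub hzR)) j
    have heq : h j z - ∑ k, (p j k z - p k j z) * f k z - g j z =
        ∑ k, (((h j z - g j z) * g k z - p j k z) - ((h k z - g k z) * g j z - p k j z)) *
          f k z := by
      rw [sub_right_comm]
      conv_lhs => rw [hk]
      rw [← Finset.sum_sub_distrib]
      exact Finset.sum_congr rfl fun k _ ↦ by ring
    rw [heq]
    calc _ ≤ ∑ k, ε / (S + 1) * C k := by
          refine norm_sum_le_of_le _ fun k _ ↦ ?_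
          rw [norm_mul]
          refine mul_le_mul ?_ (hC k z (ball_subset_closedBall hz)) (norm_nonneg _)
            (by positivity)
          refine (norm_sub_le _ _).trans ?_
          have h₁ := hpa j k z hz
          have h₂ := hpa k j z hz
          have h₃ : ε / (S + 1) = ε / (2 * (S + 1)) + ε / (2 * (S + 1)) := by
            field_simp
            norm_num
          rw [h₃]
          exact add_le_add h₁.le h₂.le
      _ = ε * (S / (S + 1)) := by
          rw [← Finset.mul_sum]
          ring
      _ ≤ ε := mul_le_of_le_one_right hε.le (div_le_one_of_le₀ (by linarith) (by linarith))

/-- A sequence of solutions of the Bézout equation on growing balls that converges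
geometrically gives rise to a global solution. -/
theorem exists_entire_bezout_of_seq {E ι : Type*} [NormedAddCommGroup E] [NormedSpace ℂ E]
    [Fintype ι] {f : ι → E → ℂ} {G : ℕ → ι → E → ℂ}
    (hG : ∀ (m : ℕ) (j), DifferentiableOn ℂ (G m j) (ball 0 (m + 2)))
    (hG1 : ∀ m : ℕ, ∀ z ∈ ball (0 : E) (m + 2), ∑ j, G m j z * f j z = 1)
    (hGd : ∀ (m : ℕ) (j), ∀ z ∈ ball (0 : E) (m + 1), ‖G (m + 1) j z - G m j z‖ ≤ 1 / 2 / 2 ^ m) :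
    ∃ g : ι → E → ℂ, (∀ j, Differentiable ℂ (g j)) ∧ ∀ z, ∑ j, g j z * f j z = 1 := by
  have hdist : ∀ (M : ℕ) (j : ι), ∀ z ∈ ball (0 : E) (M + 1), ∀ m,
      dist (G (m + M) j z) (G (m + 1 + M) j z) ≤ 1 / 2 / 2 ^ m := fun M j z hz m ↦ by
    rw [dist_comm, dist_eq_norm, add_right_comm]
    refine (hGd (m + M) j z (ball_subset_ball ?_ hz)).trans ?_
    · push_cast
      linarith [Nat.cast_nonneg (α := ℝ) m]
    · gcongr
      · norm_num
      · lia
  have hex : ∀ z : E, ∃ M : ℕ, ‖z‖ < M := fun z ↦ exists_nat_gt ‖z‖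
  have hlim : ∀ j z, ∃ y, Tendsto (fun m ↦ G m j z) atTop (𝓝 y) := fun j z ↦ by
    obtain ⟨M, hM⟩ := hex z
    obtain ⟨y, hy⟩ := cauchySeq_tendsto_of_complete (cauchySeq_of_le_geometric_two
      (hdist M j z (mem_ball_zero_iff.2 (by linarith))))
    exact ⟨y, (tendsto_add_atTop_iff_nat M).1 hy⟩
  choose g hg using hlim
  refine ⟨g, fun j z ↦ ?_, fun z ↦ ?_⟩
  · obtain ⟨M, hM⟩ := hex z
    have hsub : ball z 1 ⊆ ball 0 (M + 1) := fun w hw ↦ by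
      rw [mem_ball_zero_iff]
      have := norm_le_norm_add_norm_sub z w
      rw [mem_ball, dist_eq_norm, norm_sub_rev] at hw
      linarith
    refine differentiableAt_of_tendstoUniformlyOn_ball (G := fun m ↦ G (m + M) j) one_pos
      (fun m ↦ (hG (m + M) j).mono (hsub.trans (ball_subset_ball ?_))) ?_
    · push_cast
      linarith [Nat.cast_nonneg (α := ℝ) m]
    · rw [Metric.tendstoUniformlyOn_iff]
      intro ε hε
      have h0 : Tendsto (fun m : ℕ ↦ (1 : ℝ) / 2 ^ m) atTop (𝓝 0) := by
        simpa using tendsto_pow_atTop_nhds_zero_of_lt_one (r := (1 / 2 : ℝ)) (by norm_num)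
          (by norm_num)
      filter_upwards [h0.eventually_lt_const hε] with m hm w hw
      rw [dist_comm]
      exact (dist_le_of_le_geometric_two_of_tendsto (hdist M j w (hsub hw))
        ((tendsto_add_atTop_iff_nat M).2 (hg j w)) m).trans_lt hm
  · obtain ⟨M, hM⟩ := hex z
    refine tendsto_nhds_unique (tendsto_finsetSum Finset.univ fun j _ ↦ (hg j z).mul_const _)
      (tendsto_const_nhds.congr' ?_)
    filter_upwards [eventually_ge_atTop M] with m hm
    refine (hG1 m z (mem_ball_zero_iff.2 ?_)).symm
    have : (M : ℝ) ≤ m := by exact_mod_cast hm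
    linarith

/-- The Bézout equation is solvable in entire functions if there is no common zero. -/
theorem exists_entire_bezout {n : ℕ} {ι : Type*} [Fintype ι] {f : ι → (Fin n → ℂ) → ℂ}
    (hf : ∀ j, Differentiable ℂ (f j)) (h0 : ∀ z, ∃ j, f j z ≠ 0) :
    ∃ g : ι → (Fin n → ℂ) → ℂ, (∀ j, Differentiable ℂ (g j)) ∧
      ∀ z, ∑ j, g j z * f j z = 1 := by
  let Sol (m : ℕ) := {g : ι → (Fin n → ℂ) → ℂ //
    (∀ j, DifferentiableOn ℂ (g j) (ball 0 (m + 2))) ∧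
      ∀ z ∈ ball 0 ((m : ℝ) + 2), ∑ j, g j z * f j z = 1}
  have step : ∀ (m : ℕ) (g : Sol m), ∃ g' : Sol (m + 1), ∀ j, ∀ z ∈ ball 0 ((m : ℝ) + 1),
      ‖g'.1 j z - g.1 j z‖ ≤ 1 / 2 / 2 ^ m := fun m ⟨g, hg, hg1⟩ ↦ by
    obtain ⟨h, hh, hh1⟩ := exists_bezout_on_ball hf h0 ((m + 1 : ℕ) + 2)
    obtain ⟨g', hg', hg1', hd⟩ := exists_bezout_approx (r := m + 1) (ε := 1 / 2 / 2 ^ m) hf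
      (by positivity) (by linarith) (by push_cast; linarith) (by positivity) hg hg1 hh hh1
    exact ⟨⟨g', hg', hg1'⟩, hd⟩
  choose next hnext using step
  obtain ⟨g₀, hg₀⟩ := exists_bezout_on_ball hf h0 ((0 : ℕ) + 2)
  let G (m : ℕ) : Sol m := Nat.rec ⟨g₀, hg₀⟩ next m
  exact exists_entire_bezout_of_seq (G := fun m ↦ (G m).1) (fun m ↦ (G m).2.1)
    (fun m ↦ (G m).2.2) fun m ↦ hnext m (G m)

end

/-- Cartan's Nullstellensatz: for entire functions `f₁, …, f_N` on `ℂⁿ`, the Bézout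
equation `∑ j, g j * f j = 1` has a solution in entire functions iff the `f j` have no
common zero in `ℂⁿ`. -/
theorem cartan_nullstellensatz (n N : ℕ) (f : Fin N → (Fin n → ℂ) → ℂ)
    (hf : ∀ j, Differentiable ℂ (f j)) :
    (∃ g : Fin N → (Fin n → ℂ) → ℂ, (∀ j, Differentiable ℂ (g j)) ∧
        ∀ z, ∑ j, g j z * f j z = 1) ↔
      ∀ z : Fin n → ℂ, ∃ j, f j z ≠ 0 := by
  refine ⟨fun ⟨g, _, h1⟩ z ↦ ?_, fun h0 ↦ exists_entire_bezout hf h0⟩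
  by_contra! h
  simpa [h] using h1 z
end

section
/- If f₁,...,f_N are continuous on the closed polydisk k·𝔻̄ⁿ (radius k) and holomorphic on its interior with no common zero there, then there exist functions a₁,...,a_N, continuous on k·𝔻̄ⁿ and holomorphic inside, with ∑ a_j f_j = 1 on k·𝔻̄ⁿ. -/
open scoped BigOperators

/-- The closed polydisk of radius `k` in ℂⁿ. -/
def closedPolydiskR (n : ℕ) (k : ℝ) : Set (Fin n → ℂ) := {z | ∀ j, ‖z j‖ ≤ k}

/-- The open polydisk of radius `k` in ℂⁿ. -/
def openPolydiskR (n : ℕ) (k : ℝ) : Set (Fin n → ℂ) := {z | ∀ j, ‖z j‖ < k}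

open Metric Set Function

/-- A character of a commutative Banach algebra commutes with the Cauchy integral of the
holomorphic functional calculus with algebra-valued density. -/
lemma AlgHom.map_circleIntegral_resolvent_mul {A : Type*} [NormedCommRing A] [NormedAlgebra ℂ A]
    [CompleteSpace A] [NormOneClass A] (ψ : A →ₐ[ℂ] ℂ) {R : ℝ} (hR : 0 ≤ R) {a : A} (ha : ‖a‖ < R)
    {G : ℂ → A} (hG : ContinuousOn G (sphere 0 R)) :
    ψ (∮ ζ in C(0, R), resolvent a ζ * G ζ) = ∮ ζ in C(0, R), (ζ - ψ a)⁻¹ • ψ (G ζ) := by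
  have hmem : ∀ ζ ∈ sphere (0 : ℂ) R, ζ ∈ resolventSet ℂ a := fun ζ hζ =>
    spectrum.mem_resolventSet_of_norm_lt (by rw [mem_sphere_zero_iff_norm.1 hζ]; exact ha)
  have hcont : ContinuousOn (fun ζ => resolvent a ζ * G ζ) (sphere 0 R) :=
    ContinuousOn.mul (fun ζ hζ =>
      (spectrum.hasDerivAt_resolvent_const_left (hmem ζ hζ)).continuousAt.continuousWithinAt) hG
  have hint : CircleIntegrable (fun ζ => resolvent a ζ * G ζ) 0 R := hcont.circleIntegrable hR
  have hcomm : ψ (∮ ζ in C(0, R), resolvent a ζ * G ζ)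
      = ∮ ζ in C(0, R), ψ (resolvent a ζ * G ζ) := by
    have := ψ.toContinuousLinearMap.intervalIntegral_comp_comm hint.out
    simp only [circleIntegral]
    simpa using this.symm
  rw [hcomm]
  refine circleIntegral.integral_congr hR fun ζ hζ => ?_
  have hu : IsUnit (algebraMap ℂ A ζ - a) := hmem ζ hζ
  have hinv : (ζ - ψ a) * ψ (resolvent a ζ) = 1 := by
    have := congrArg ψ (Ring.mul_inverse_cancel _ hu)
    simpa [resolvent] using this
  simp only [map_mul, smul_eq_mul]
  rw [eq_inv_of_mul_eq_one_right hinv]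

/-- Elements of a commutative Banach algebra with no common zero in the Gelfand spectrum
generate the unit ideal. -/
lemma exists_sum_mul_eq_one_of_algHom {A ι : Type*} [Fintype ι] [NormedCommRing A]
    [NormedAlgebra ℂ A] [CompleteSpace A] (f : ι → A)
    (hf : ∀ φ : A →ₐ[ℂ] ℂ, ∃ j, φ (f j) ≠ 0) : ∃ c : ι → A, ∑ j, c j * f j = 1 := by
  refine Ideal.mem_span_range_iff_exists_fun.1 ((Ideal.eq_top_iff_one _).1 ?_)
  by_contra hne
  obtain ⟨M, hM, hle⟩ := Ideal.exists_le_maximal _ hne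
  obtain ⟨j, hj⟩ := hf (WeakDual.CharacterSpace.equivAlgHom M.toCharacterSpace)
  exact hj (M.toCharacterSpace_apply_eq_zero_of_mem (hle (Ideal.subset_span (mem_range_self j))))

variable {n : ℕ} {k : ℝ}

instance : CompactSpace (closedPolydiskR n k) := by
  rw [← isCompact_iff_compactSpace]
  have : closedPolydiskR n k = Set.pi univ fun _ => closedBall 0 k := by
    ext z; simp [closedPolydiskR]
  rw [this]
  exact isCompact_univ_pi fun _ => isCompact_closedBall _ _

/-- The algebra of restrictions to the closed polydisk of functions holomorphic around it. -/
noncomputable def holomorphicNear (n : ℕ) (k : ℝ) : Subalgebra ℂ C(closedPolydiskR n k, ℂ) where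
  carrier := {f | ∃ F : (Fin n → ℂ) → ℂ,
    (∀ z ∈ closedPolydiskR n k, DifferentiableAt ℂ F z) ∧ ∀ z, f z = F z}
  mul_mem' := by
    rintro f g ⟨F, hF, hfF⟩ ⟨G, hG, hgG⟩
    exact ⟨F * G, fun z hz => (hF z hz).mul (hG z hz), fun z => by simp [hfF, hgG]⟩
  add_mem' := by
    rintro f g ⟨F, hF, hfF⟩ ⟨G, hG, hgG⟩
    exact ⟨F + G, fun z hz => (hF z hz).add (hG z hz), fun z => by simp [hfF, hgG]⟩
  algebraMap_mem' c := ⟨fun _ => c, fun _ _ => differentiableAt_const c, fun _ => rfl⟩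

/-- The uniform closure of `holomorphicNear`. -/
noncomputable abbrev polydiskAlgebra (n : ℕ) (k : ℝ) : Subalgebra ℂ C(closedPolydiskR n k, ℂ) :=
  (holomorphicNear n k).topologicalClosure

lemma holomorphicNear_le_polydiskAlgebra : holomorphicNear n k ≤ polydiskAlgebra n k :=
  Subalgebra.le_topologicalClosure _

instance : CompleteSpace (polydiskAlgebra n k) :=
  (Subalgebra.isClosed_topologicalClosure _).completeSpace_coe

instance [Nonempty (closedPolydiskR n k)] : NormOneClass (polydiskAlgebra n k) :=
  ⟨norm_one (α := C(closedPolydiskR n k, ℂ))⟩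

lemma update_mem_closedPolydiskR {z : Fin n → ℂ} (hz : z ∈ closedPolydiskR n k) (j : Fin n)
    {ζ : ℂ} (hζ : ‖ζ‖ ≤ k) : update z j ζ ∈ closedPolydiskR n k := fun i => by
  rcases eq_or_ne i j with rfl | h
  · simpa using hζ
  · simpa [h] using hz i

/-- The coordinate functions. -/
def polydiskCoord (n : ℕ) (k : ℝ) (j : Fin n) : C(closedPolydiskR n k, ℂ) :=
  ⟨fun z => z.1 j, (continuous_apply j).comp continuous_subtype_val⟩

lemma polydiskCoord_mem (j : Fin n) : polydiskCoord n k j ∈ holomorphicNear n k :=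
  ⟨fun z => z j, fun _ _ => by fun_prop, fun _ => rfl⟩

lemma norm_polydiskCoord_le (hk : 0 ≤ k) (j : Fin n) : ‖polydiskCoord n k j‖ ≤ k :=
  (ContinuousMap.norm_le _ hk).2 fun z => z.2 j

/-- Evaluation at a point of the polydisk. -/
noncomputable def evalPolydisk (z : closedPolydiskR n k) : polydiskAlgebra n k →ₐ[ℂ] ℂ :=
  (ContinuousMap.evalAlgHom ℂ ℂ z).comp (polydiskAlgebra n k).val

/-- Substitution of a constant for the `j`-th coordinate. -/
def substCoord (j : Fin n) : C(closedBall (0 : ℂ) k × closedPolydiskR n k, closedPolydiskR n k) :=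
  ⟨fun p => ⟨update p.2.1 j p.1, update_mem_closedPolydiskR p.2.2 j (mem_closedBall_zero_iff.1 p.1.2)⟩,
    Continuous.subtype_mk (Continuous.update (continuous_subtype_val.comp continuous_snd) j
      (continuous_subtype_val.comp continuous_fst : Continuous fun p :
        closedBall (0 : ℂ) k × closedPolydiskR n k => (p.1 : ℂ))) _⟩

/-- Multiplication of the `j`-th coordinate by a number of the unit interval. -/
def scaleCoord (j : Fin n) : C(unitInterval × closedPolydiskR n k, closedPolydiskR n k) :=
  ⟨fun p => ⟨update p.2.1 j ((p.1 : ℝ) * p.2.1 j), update_mem_closedPolydiskR p.2.2 j (by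
    rw [norm_mul, Complex.norm_real, Real.norm_of_nonneg p.1.2.1]
    exact (mul_le_of_le_one_left (norm_nonneg _) p.1.2.2).trans (p.2.2 j))⟩,
    Continuous.subtype_mk ((continuous_subtype_val.comp continuous_snd).update j
      ((Complex.continuous_ofReal.comp (continuous_subtype_val.comp continuous_fst)).mul
        ((continuous_apply j).comp (continuous_subtype_val.comp continuous_snd)))) _⟩

lemma differentiableAt_update_fun {E : Type*} [NormedAddCommGroup E] [NormedSpace ℂ E]
    {u : E → Fin n → ℂ} {v : E → ℂ} {x : E} (j : Fin n) (hu : DifferentiableAt ℂ u x)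
    (hv : DifferentiableAt ℂ v x) : DifferentiableAt ℂ (fun y => update (u y) j (v y)) x := by
  rw [differentiableAt_pi] at hu ⊢
  intro i
  rcases eq_or_ne i j with rfl | h
  · simpa using hv
  · simpa [h] using hu i

lemma curry_substCoord_mem {f : C(closedPolydiskR n k, ℂ)} (hf : f ∈ holomorphicNear n k)
    (j : Fin n) (ζ : closedBall (0 : ℂ) k) :
    (f.comp (substCoord j)).curry ζ ∈ holomorphicNear n k := by
  obtain ⟨F, hF, hfF⟩ := hf
  refine ⟨fun z => F (update z j ζ), fun z hz => ?_, fun z => hfF _⟩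
  exact DifferentiableAt.comp z (hF _ (update_mem_closedPolydiskR hz j (mem_closedBall_zero_iff.1 ζ.2)))
    (differentiableAt_update_fun j differentiableAt_id (differentiableAt_const _))

lemma curry_scaleCoord_mem {f : C(closedPolydiskR n k, ℂ)} (hf : f ∈ holomorphicNear n k)
    (j : Fin n) (r : unitInterval) :
    (f.comp (scaleCoord j)).curry r ∈ holomorphicNear n k := by
  obtain ⟨F, hF, hfF⟩ := hf
  refine ⟨fun z => F (update z j ((r : ℝ) * z j)), fun z hz => ?_, fun z => hfF _⟩
  exact DifferentiableAt.comp z (hF _ (scaleCoord j (r, ⟨z, hz⟩)).2)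
    (differentiableAt_update_fun j differentiableAt_id (by fun_prop))

/-- The `polydiskAlgebra`-valued map freezing the `j`-th coordinate of `f`. -/
noncomputable def freezeCoord (f : holomorphicNear n k) (j : Fin n) (ζ : closedBall (0 : ℂ) k) :
    polydiskAlgebra n k :=
  ⟨(f.1.comp (substCoord j)).curry ζ,
    holomorphicNear_le_polydiskAlgebra (curry_substCoord_mem f.2 j ζ)⟩

lemma continuous_freezeCoord (f : holomorphicNear n k) (j : Fin n) :
    Continuous (freezeCoord f j) :=
  Continuous.subtype_mk (ContinuousMap.continuous _) _

/-- The `polydiskAlgebra`-valued map contracting the `j`-th coordinate of `f`. -/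
noncomputable def contractCoord (f : holomorphicNear n k) (j : Fin n) (r : unitInterval) :
    polydiskAlgebra n k :=
  ⟨(f.1.comp (scaleCoord j)).curry r,
    holomorphicNear_le_polydiskAlgebra (curry_scaleCoord_mem f.2 j r)⟩

lemma continuous_contractCoord (f : holomorphicNear n k) (j : Fin n) :
    Continuous (contractCoord f j) :=
  Continuous.subtype_mk (ContinuousMap.continuous _) _

/-- Cauchy's formula in the `j`-th variable, with values in the algebra: the Cauchy integral at
an algebra element `a` substitutes `a` for the `j`-th coordinate. -/
lemma evalPolydisk_cauchy [NormOneClass (polydiskAlgebra n k)] (f : holomorphicNear n k)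
    (j : Fin n) {G : ℂ → polydiskAlgebra n k}
    (hG : ∀ ζ : closedBall (0 : ℂ) k, G ζ = freezeCoord f j ζ)
    (hGc : ContinuousOn G (sphere 0 k)) (hk : 0 < k) {a : polydiskAlgebra n k} (ha : ‖a‖ < k)
    (z : closedPolydiskR n k) (haz : ‖evalPolydisk z a‖ ≤ k) :
    evalPolydisk z (∮ ζ in C(0, k), resolvent a ζ * G ζ)
      = (2 * Real.pi * Complex.I) • evalPolydisk z
          (freezeCoord f j ⟨evalPolydisk z a, by simpa using haz⟩) := by
  obtain ⟨F, hF, hfF⟩ := f.2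
  have heval (ζ : closedBall (0 : ℂ) k) :
      evalPolydisk z (freezeCoord f j ζ) = F (update z.1 j ζ) := hfF _
  rw [AlgHom.map_circleIntegral_resolvent_mul _ hk.le ha hGc, heval]
  have hdiff : DifferentiableOn ℂ (fun ζ => F (update z.1 j ζ)) (closedBall 0 k) := fun ζ hζ =>
    (DifferentiableAt.comp ζ (hF _ (update_mem_closedPolydiskR z.2 j (by simpa using hζ)))
      (differentiableAt_update_fun j (differentiableAt_const _)
        differentiableAt_id)).differentiableWithinAt
  have hw : evalPolydisk z a ∈ ball (0 : ℂ) k := by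
    rw [mem_ball_zero_iff]
    exact (AlgHom.norm_apply_le_self (evalPolydisk z) a).trans_lt ha
  rw [← (hdiff.diffContOnCl_ball subset_rfl).circleIntegral_sub_inv_smul hw]
  refine circleIntegral.integral_congr hk.le fun ζ hζ => ?_
  rw [hG ⟨ζ, sphere_subset_closedBall hζ⟩, heval]

lemma character_contractCoord [NormOneClass (polydiskAlgebra n k)] (hk : 0 < k)
    (φ : polydiskAlgebra n k →ₐ[ℂ] ℂ) (f : holomorphicNear n k) (j : Fin n) {w : ℂ}
    (hw : ‖w‖ ≤ k) (hφ : φ ⟨polydiskCoord n k j,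
      holomorphicNear_le_polydiskAlgebra (polydiskCoord_mem j)⟩ = w) :
    φ (contractCoord f j 1) = φ (freezeCoord f j ⟨w, by simpa using hw⟩) := by
  classical
  let G : ℂ → polydiskAlgebra n k := fun ζ =>
    if h : ζ ∈ closedBall (0 : ℂ) k then freezeCoord f j ⟨ζ, h⟩ else 0
  have hG : ∀ ζ : closedBall (0 : ℂ) k, G ζ = freezeCoord f j ζ := fun ζ => dif_pos ζ.2
  have hGc : ContinuousOn G (sphere 0 k) := by
    refine ContinuousOn.mono ?_ sphere_subset_closedBall
    rw [continuousOn_iff_continuous_domRestrict]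
    exact (continuous_freezeCoord f j).congr fun ζ => (hG ζ).symm
  have hpi : (2 * Real.pi * Complex.I : ℂ) ≠ 0 := Complex.two_pi_I_ne_zero
  have hext {a b : polydiskAlgebra n k} (h : ∀ z, evalPolydisk z a = evalPolydisk z b) : a = b :=
    Subtype.ext (ContinuousMap.ext h)
  let Z : polydiskAlgebra n k :=
    ⟨polydiskCoord n k j, holomorphicNear_le_polydiskAlgebra (polydiskCoord_mem j)⟩
  have hscale (r : unitInterval) : ‖(r : ℂ) * w‖ ≤ k := by
    rw [norm_mul, Complex.norm_real, Real.norm_of_nonneg r.2.1]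
    exact (mul_le_of_le_one_left (norm_nonneg _) r.2.2).trans hw
  have hlt : EqOn (fun r => φ (contractCoord f j r))
      (fun r => φ (freezeCoord f j ⟨(r : ℂ) * w, mem_closedBall_zero_iff.2 (hscale r)⟩))
      (Iio 1) := by
    intro r hr
    have hr1 : (r : ℝ) < 1 := hr
    have hr' : ‖((r : ℝ) : ℂ)‖ * k < k := by
      rw [Complex.norm_real, Real.norm_of_nonneg r.2.1]
      nlinarith
    have ha : ‖((r : ℝ) : ℂ) • Z‖ < k := by
      rw [norm_smul]
      exact (mul_le_mul_of_nonneg_left (norm_polydiskCoord_le hk.le j) (norm_nonneg _)).trans_lt hr'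
    have hb : ‖algebraMap ℂ (polydiskAlgebra n k) ((r : ℝ) * w)‖ < k := by
      rw [norm_algebraMap', norm_mul]
      exact (mul_le_mul_of_nonneg_left hw (norm_nonneg _)).trans_lt hr'
    have hA : ∮ ζ in C(0, k), resolvent (((r : ℝ) : ℂ) • Z) ζ * G ζ
        = (2 * Real.pi * Complex.I) • contractCoord f j r := hext fun z => by
      rw [evalPolydisk_cauchy f j hG hGc hk ha z
        ((AlgHom.norm_apply_le_self (evalPolydisk z) _).trans ha.le)]
      exact (map_smul (evalPolydisk z) _ (contractCoord f j r)).symm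
    have hB : ∮ ζ in C(0, k), resolvent (algebraMap ℂ (polydiskAlgebra n k) ((r : ℝ) * w)) ζ * G ζ
        = (2 * Real.pi * Complex.I) •
          freezeCoord f j ⟨(r : ℂ) * w, mem_closedBall_zero_iff.2 (hscale r)⟩ := hext fun z => by
      rw [evalPolydisk_cauchy f j hG hGc hk hb z
        ((AlgHom.norm_apply_le_self (evalPolydisk z) _).trans hb.le)]
      exact (map_smul (evalPolydisk z) _ (freezeCoord f j
        ⟨(r : ℂ) * w, mem_closedBall_zero_iff.2 (hscale r)⟩)).symm
    have key : φ (∮ ζ in C(0, k), resolvent (((r : ℝ) : ℂ) • Z) ζ * G ζ)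
        = φ (∮ ζ in C(0, k),
          resolvent (algebraMap ℂ (polydiskAlgebra n k) ((r : ℝ) * w)) ζ * G ζ) := by
      rw [AlgHom.map_circleIntegral_resolvent_mul φ hk.le ha hGc,
        AlgHom.map_circleIntegral_resolvent_mul φ hk.le hb hGc, map_smul, hφ, AlgHom.commutes]
      rfl
    rw [hA, hB, map_smul, map_smul] at key
    exact smul_right_injective ℂ hpi key
  have hφc : Continuous φ := φ.toContinuousLinearMap.continuous
  have hdense : Dense (Iio (1 : unitInterval)) := by
    rw [dense_iff_closure_eq, closure_Iio' ⟨0, zero_lt_one⟩]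
    exact eq_univ_of_forall fun r => r.2.2
  have heq := Continuous.ext_on hdense (hφc.comp (continuous_contractCoord f j))
    (hφc.comp ((continuous_freezeCoord f j).comp (Continuous.subtype_mk
      ((Complex.continuous_ofReal.comp continuous_subtype_val).mul continuous_const) _))) hlt
  have h1 := congrFun heq 1
  simpa using h1

lemma contractCoord_one (f : holomorphicNear n k) (j : Fin n) :
    (contractCoord f j 1).1 = f.1 := by
  ext z
  refine congrArg f.1 (Subtype.ext ?_)
  simp [scaleCoord]

/-- Every character of the polydisk algebra is the evaluation at a point. -/
lemma exists_eq_evalPolydisk [NormOneClass (polydiskAlgebra n k)] (hk : 0 < k)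
    (φ : polydiskAlgebra n k →ₐ[ℂ] ℂ) : ∃ w, φ = evalPolydisk w := by
  classical
  let w : closedPolydiskR n k := ⟨fun j => φ ⟨polydiskCoord n k j,
      holomorphicNear_le_polydiskAlgebra (polydiskCoord_mem j)⟩, fun j =>
    (AlgHom.norm_apply_le_self φ _).trans (norm_polydiskCoord_le hk.le j)⟩
  refine ⟨w, ?_⟩
  have hstep (f : holomorphicNear n k) (S : Finset (Fin n)) : ∃ g : holomorphicNear n k,
      φ ⟨g.1, holomorphicNear_le_polydiskAlgebra g.2⟩
        = φ ⟨f.1, holomorphicNear_le_polydiskAlgebra f.2⟩ ∧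
      ∀ z u : closedPolydiskR n k, u.1 = S.piecewise w.1 z.1 → g.1 z = f.1 u := by
    induction S using Finset.induction_on with
    | empty =>
      refine ⟨f, rfl, fun z u hu => congrArg f.1 (Subtype.ext ?_)⟩
      simpa using hu.symm
    | insert j S hj ih =>
      obtain ⟨g, hg, hgz⟩ := ih
      refine ⟨⟨_, curry_substCoord_mem g.2 j ⟨w.1 j, mem_closedBall_zero_iff.2 (w.2 j)⟩⟩, ?_, ?_⟩
      · rw [← hg]
        refine (character_contractCoord hk φ g j (w.2 j) rfl).symm.trans (congrArg φ ?_)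
        exact Subtype.ext (contractCoord_one g j)
      · intro z u hu
        refine hgz _ u ?_
        rw [hu]
        ext i
        rcases eq_or_ne i j with rfl | h
        · simp [substCoord, hj]
        · by_cases hi : i ∈ S <;> simp [substCoord, h, hi]
  have hφc : Continuous φ := φ.toContinuousLinearMap.continuous
  have hwc : Continuous (evalPolydisk w) := (evalPolydisk w).toContinuousLinearMap.continuous
  have hdense : Dense {a : polydiskAlgebra n k | a.1 ∈ holomorphicNear n k} := by
    intro a
    rw [closure_subtype]
    refine closure_mono (fun b hb => ?_) a.2
    exact ⟨⟨b, holomorphicNear_le_polydiskAlgebra hb⟩, hb, rfl⟩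
  refine DFunLike.coe_injective (Continuous.ext_on hdense hφc hwc fun a ha => ?_)
  obtain ⟨g, hg, hgz⟩ := hstep ⟨a.1, ha⟩ Finset.univ
  have hconst : (⟨g.1, holomorphicNear_le_polydiskAlgebra g.2⟩ : polydiskAlgebra n k)
      = algebraMap ℂ _ (a.1 w) := by
    refine Subtype.ext (ContinuousMap.ext fun z => ?_)
    exact hgz z w (by simp)
  rw [hconst, AlgHom.commutes] at hg
  exact hg.symm

/-- A function continuous on the closed polydisk and holomorphic inside is a uniform limit of
functions holomorphic around the closed polydisk. -/
lemma mem_polydiskAlgebra (hk : 0 < k) {F : (Fin n → ℂ) → ℂ}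
    (hF : DifferentiableOn ℂ F (openPolydiskR n k)) {f : C(closedPolydiskR n k, ℂ)}
    (hfF : ∀ z, f z = F z) : f ∈ polydiskAlgebra n k := by
  let D : C(unitInterval × closedPolydiskR n k, closedPolydiskR n k) :=
    ⟨fun p => ⟨((p.1 : ℝ) : ℂ) • p.2.1, fun j => by
      rw [Pi.smul_apply, norm_smul, Complex.norm_real, Real.norm_of_nonneg p.1.2.1]
      exact (mul_le_of_le_one_left (norm_nonneg _) p.1.2.2).trans (p.2.2 j)⟩,
      Continuous.subtype_mk ((Complex.continuous_ofReal.comp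
        (continuous_subtype_val.comp continuous_fst)).smul
          (continuous_subtype_val.comp continuous_snd)) _⟩
  have hopen : IsOpen (openPolydiskR n k) := by
    have : openPolydiskR n k = Set.pi univ fun _ => ball 0 k := by
      ext z; simp [openPolydiskR]
    rw [this]
    exact isOpen_set_pi finite_univ fun _ _ => isOpen_ball
  have h1 : (f.comp D).curry 1 = f := by
    ext z
    refine congrArg f (Subtype.ext ?_)
    simp [D]
  have hmem : (1 : unitInterval) ∈ closure (Iio 1) := by
    rw [closure_Iio' ⟨0, zero_lt_one⟩]
    exact le_refl (1 : unitInterval)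
  rw [← h1]
  refine map_mem_closure (ContinuousMap.continuous _) hmem fun r hr => ?_
  have hr1 : (r : ℝ) < 1 := hr
  refine ⟨fun z => F (((r : ℝ) : ℂ) • z), fun z hz => ?_, fun z => hfF _⟩
  refine DifferentiableAt.comp z (hF.differentiableAt (hopen.mem_nhds fun j => ?_))
    (differentiableAt_id.fun_const_smul _)
  rw [Pi.smul_apply, norm_smul, Complex.norm_real, Real.norm_of_nonneg r.2.1]
  nlinarith [hz j, r.2.1]

/-- Bézout on a polydisk of radius `k`: functions continuous on the closed polydisk of
radius `k` and holomorphic on its interior, with no common zero there, admit a Bézout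
solution in the same algebra. -/
theorem bezout_on_polydisk (n N : ℕ) (k : ℝ) (hk : 0 < k)
    (f : Fin N → (Fin n → ℂ) → ℂ)
    (hfc : ∀ j, ContinuousOn (f j) (closedPolydiskR n k))
    (hfd : ∀ j, DifferentiableOn ℂ (f j) (openPolydiskR n k))
    (hz : ∀ z ∈ closedPolydiskR n k, ∃ j, f j z ≠ 0) :
    ∃ a : Fin N → (Fin n → ℂ) → ℂ,
      (∀ j, ContinuousOn (a j) (closedPolydiskR n k)) ∧
      (∀ j, DifferentiableOn ℂ (a j) (openPolydiskR n k)) ∧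
      ∀ z ∈ closedPolydiskR n k, ∑ j, a j z * f j z = 1 := by
  let f' : Fin N → C(closedPolydiskR n k, ℂ) := fun j => ⟨_, (hfc j).domRestrict⟩
  have hf' (j : Fin N) : f' j ∈ polydiskAlgebra n k := mem_polydiskAlgebra hk (hfd j) fun _ => rfl
  have : Nonempty (closedPolydiskR n k) := ⟨⟨0, fun j => by simpa using hk.le⟩⟩
  obtain ⟨c, hc⟩ := exists_sum_mul_eq_one_of_algHom
    (fun j => (⟨f' j, hf' j⟩ : polydiskAlgebra n k)) fun φ => by
      obtain ⟨w, rfl⟩ := exists_eq_evalPolydisk hk φ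
      exact hz w w.2
  have hc' : ∑ j, (c j).1 * f' j = 1 := by
    simpa using congrArg (polydiskAlgebra n k).val hc
  have hΦ : Continuous fun p : Fin N → C(closedPolydiskR n k, ℂ) => ‖∑ j, p j * f' j - 1‖ := by
    fun_prop
  have hcl : (fun j => (c j).1) ∈
      closure (Set.pi univ fun _ : Fin N => (holomorphicNear n k : Set C(closedPolydiskR n k, ℂ))) := by
    rw [closure_pi_set]
    exact fun j _ => (c j).2
  obtain ⟨p, hp, hpmem⟩ := mem_closure_iff.1 hcl _ (isOpen_lt hΦ continuous_const)
    (show ‖∑ j, (c j).1 * f' j - 1‖ < 1 by simp [hc'])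
  choose P hP hpP using fun j => hpmem j (mem_univ j)
  have hne : ∀ z ∈ closedPolydiskR n k, ∑ j, P j z * f j z ≠ 0 := by
    intro z hzK h0
    have hle := (ContinuousMap.norm_coe_le_norm (∑ j, p j * f' j - 1) ⟨z, hzK⟩).trans_lt hp
    have hsum : (∑ j, p j * f' j - 1) ⟨z, hzK⟩ = ∑ j, P j z * f j z - 1 := by
      simp [hpP, f']
    rw [hsum, h0] at hle
    simp at hle
  have hsub : openPolydiskR n k ⊆ closedPolydiskR n k := fun z hz j => (hz j).le
  have hPc (j : Fin N) : ContinuousOn (P j) (closedPolydiskR n k) := fun z hz =>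
    (hP j z hz).continuousAt.continuousWithinAt
  have hPd (j : Fin N) : DifferentiableOn ℂ (P j) (openPolydiskR n k) := fun z hz =>
    (hP j z (hsub hz)).differentiableWithinAt
  refine ⟨fun j z => P j z / ∑ i, P i z * f i z, fun j => ?_, fun j => ?_, fun z hzK => ?_⟩
  · exact (hPc j).div (continuousOn_finsetSum _ fun i _ => (hPc i).mul (hfc i)) hne
  · have hsum : DifferentiableOn ℂ (fun z => ∑ i, P i z * f i z) (openPolydiskR n k) :=
      DifferentiableOn.fun_sum fun i _ => (hPd i).mul (hfd i)
    simp only [div_eq_mul_inv]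
    exact (hPd j).mul (hsum.inv fun z hz => hne z (hsub hz))
  · simp_rw [div_mul_eq_mul_div]
    rw [← Finset.sum_div, div_self (hne z hzK)]
end
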